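/- Let X be a compact metric space and T a topological semigroup acting on X by continuous maps. If the action of T on X is strongly proximal, then the induced action of T on P(X) is strongly proximal: for every ρ ∈ P(P(X)) there exists a sequence (tₙ) in T and a point x ∈ X such that tₙρ converges in P(P(X)) to the Dirac measure at δₓ. -/

import Mathlib

open MeasureTheory Filter Topology BoundedContinuousFunction
open scoped ENNReal NNReal

noncomputable instance instMSPM {Ω : Type*} [MeasurableSpace Ω] [TopologicalSpace Ω]
    [OpensMeasurableSpace Ω] : MeasurableSpace (ProbabilityMeasure Ω) := borel _

instance instBSPM {Ω : Type*} [MeasurableSpace Ω] [TopologicalSpace Ω]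
    [OpensMeasurableSpace Ω] : BorelSpace (ProbabilityMeasure Ω) := ⟨rfl⟩

noncomputable def push {X : Type*} [MeasurableSpace X] [TopologicalSpace X] [BorelSpace X]
    (t : C(X, X)) (μ : ProbabilityMeasure X) : ProbabilityMeasure X :=
  μ.map t.continuous.measurable.aemeasurable

noncomputable def push2 {X : Type*} [MeasurableSpace X] [TopologicalSpace X] [BorelSpace X]
    (t : C(X, X)) (ρ : ProbabilityMeasure (ProbabilityMeasure X)) :
    ProbabilityMeasure (ProbabilityMeasure X) :=
  ρ.map (ProbabilityMeasure.continuous_map t.continuous).measurable.aemeasurable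

noncomputable def diracPM {X : Type*} [MeasurableSpace X] (x : X) : ProbabilityMeasure X :=
  ⟨Measure.dirac x, inferInstance⟩

/-- Evaluation of measures is measurable for the Borel σ-algebra of the weak topology. -/
theorem measurable_toMeasure_borel {X : Type*} [TopologicalSpace X] [HasOuterApproxClosed X]
    [MeasurableSpace X] [BorelSpace X] :
    Measurable fun μ : ProbabilityMeasure X ↦ (μ : Measure X) := by
  refine Measurable.measure_of_isPiSystem_of_isProbabilityMeasure
    (borel_eq_generateFrom_isClosed (α := X) ▸ BorelSpace.measurable_eq) isPiSystem_isClosed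
    fun F hF ↦ ?_
  refine measurable_of_tendsto_metrizable (f := fun n (μ : ProbabilityMeasure X) ↦
    ∫⁻ x, hF.apprSeq n x ∂(μ : Measure X)) (fun n ↦ ?_) ?_
  · exact (ProbabilityMeasure.continuous_lintegral_boundedContinuousFunction _).measurable
  · exact tendsto_pi_nhds.2 fun μ ↦ HasOuterApproxClosed.tendsto_lintegral_apprSeq hF _

/-- The barycenter of a probability measure on the space of probability measures. -/
noncomputable def barycenter {X : Type*} [TopologicalSpace X] [HasOuterApproxClosed X]
    [MeasurableSpace X] [BorelSpace X] (ρ : ProbabilityMeasure (ProbabilityMeasure X)) :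
    ProbabilityMeasure X :=
  ⟨((ρ : Measure (ProbabilityMeasure X)).map
    (fun μ : ProbabilityMeasure X ↦ (μ : Measure X))).join, ⟨by
    rw [Measure.join_apply MeasurableSet.univ,
      lintegral_map (Measure.measurable_coe MeasurableSet.univ) measurable_toMeasure_borel]
    simp⟩⟩

theorem lintegral_barycenter {X : Type*} [TopologicalSpace X] [HasOuterApproxClosed X]
    [MeasurableSpace X] [BorelSpace X] (ρ : ProbabilityMeasure (ProbabilityMeasure X))
    {f : X → ℝ≥0∞} (hf : Measurable f) :
    ∫⁻ x, f x ∂(barycenter ρ : Measure X) =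
      ∫⁻ μ, ∫⁻ x, f x ∂(μ : Measure X) ∂(ρ : Measure (ProbabilityMeasure X)) := by
  change ∫⁻ x, f x ∂(Measure.join _) = _
  rw [Measure.lintegral_join hf.aemeasurable,
    lintegral_map (Measure.measurable_lintegral hf) measurable_toMeasure_borel]

/-- Convergence of the mean distance to a point forces weak convergence to the Dirac mass. -/
theorem tendsto_diracPM_of_lintegral_edist {X : Type*} [PseudoMetricSpace X]
    [MeasurableSpace X] [BorelSpace X] {ν : ℕ → ProbabilityMeasure X} {x : X}
    (h : Tendsto (fun n ↦ ∫⁻ y, edist y x ∂(ν n : Measure X)) atTop (𝓝 0)) :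
    Tendsto ν atTop (𝓝 (diracPM x)) := by
  refine tendsto_of_forall_isClosed_limsup_le' fun F hF ↦ ?_
  by_cases hx : x ∈ F
  · refine (limsup_le_of_le (a := 1) (by isBoundedDefault)
      (Eventually.of_forall fun n ↦ prob_le_one)).trans ?_
    simp [diracPM, Measure.dirac_apply_of_mem hx]
  · obtain ⟨r, hr, hrF⟩ := Metric.isOpen_iff.1 hF.isOpen_compl x hx
    have hr0 : ENNReal.ofReal r ≠ 0 := by simpa using hr
    have hle (n : ℕ) : (ν n : Measure X) F ≤
        (∫⁻ y, edist y x ∂(ν n : Measure X)) / ENNReal.ofReal r := by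
      refine (measure_mono fun y hy ↦ ?_).trans
        (meas_ge_le_lintegral_div (by fun_prop) hr0 ENNReal.ofReal_ne_top)
      have : r ≤ dist y x := not_lt.1 fun hlt ↦ hrF (Metric.mem_ball.2 hlt) hy
      rw [Set.mem_ofPred_eq, edist_dist]
      exact ENNReal.ofReal_le_ofReal this
    have hlim : Tendsto (fun n ↦ (ν n : Measure X) F) atTop (𝓝 0) := by
      refine tendsto_of_tendsto_of_tendsto_of_le_of_le tendsto_const_nhds ?_
        (fun _ ↦ zero_le) hle
      simpa using ENNReal.Tendsto.div_const h (Or.inr hr0)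
    rw [hlim.limsup_eq]
    exact zero_le

theorem lintegral_push {X : Type*} [MeasurableSpace X] [TopologicalSpace X] [BorelSpace X]
    (t : C(X, X)) (μ : ProbabilityMeasure X) {f : X → ℝ≥0∞} (hf : Measurable f) :
    ∫⁻ y, f y ∂(push t μ : Measure X) = ∫⁻ y, f (t y) ∂(μ : Measure X) :=
  lintegral_map hf t.continuous.measurable

theorem continuous_push {X : Type*} [MeasurableSpace X] [TopologicalSpace X] [BorelSpace X]
    (t : C(X, X)) : Continuous (push t) :=
  ProbabilityMeasure.continuous_map t.continuous

theorem integral_push2 {X : Type*} [MeasurableSpace X] [TopologicalSpace X] [BorelSpace X]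
    (t : C(X, X)) (ρ : ProbabilityMeasure (ProbabilityMeasure X))
    (f : ProbabilityMeasure X →ᵇ ℝ) :
    ∫ μ, f μ ∂(push2 t ρ : Measure (ProbabilityMeasure X)) =
      ∫ μ, f (push t μ) ∂(ρ : Measure (ProbabilityMeasure X)) :=
  integral_map (continuous_push t).measurable.aemeasurable
    f.continuous.measurable.aestronglyMeasurable

theorem continuous_lintegral_edist {X : Type*} [PseudoMetricSpace X] [CompactSpace X]
    [MeasurableSpace X] [BorelSpace X] (x : X) :
    Continuous fun μ : ProbabilityMeasure X ↦ ∫⁻ y, edist y x ∂(μ : Measure X) := by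
  simp only [edist_nndist]
  exact ProbabilityMeasure.continuous_lintegral_continuousMap
      (⟨fun y ↦ nndist y x, by fun_prop⟩ : C(X, ℝ≥0))

theorem lintegral_edist_ne_top {X : Type*} [PseudoMetricSpace X] [CompactSpace X]
    [MeasurableSpace X] (x : X) (μ : ProbabilityMeasure X) :
    ∫⁻ y, edist y x ∂(μ : Measure X) ≠ ∞ := by
  refine ne_top_of_le_ne_top (b := ENNReal.ofReal (Metric.diam (Set.univ : Set X))) (by simp) ?_
  refine (lintegral_mono (g := fun _ ↦ ENNReal.ofReal (Metric.diam (Set.univ : Set X)))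
    fun y ↦ ?_).trans (by simp)
  simp only [edist_dist]
  exact ENNReal.ofReal_le_ofReal
    (Metric.dist_le_diam_of_mem isCompact_univ.isBounded (Set.mem_univ _) (Set.mem_univ _))

/-- If the barycenters of the translates of `ρ` converge to a Dirac mass at `x`, then almost
every measure converges to that Dirac mass along a subsequence. -/
theorem exists_subseq_ae_tendsto_push {X : Type*} [PseudoMetricSpace X] [CompactSpace X]
    [MeasurableSpace X] [BorelSpace X] (ρ : ProbabilityMeasure (ProbabilityMeasure X))
    {s : ℕ → C(X, X)} {x : X}
    (h : Tendsto (fun n ↦ push (s n) (barycenter ρ)) atTop (𝓝 (diracPM x))) :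
    ∃ ms : ℕ → ℕ, ∀ᵐ μ ∂(ρ : Measure (ProbabilityMeasure X)),
      Tendsto (fun n ↦ push (s (ms n)) μ) atTop (𝓝 (diracPM x)) := by
  let G : ℕ → ProbabilityMeasure X → ℝ := fun n μ ↦
    (∫⁻ y, edist y x ∂(push (s n) μ : Measure X)).toReal
  have hmeas (n : ℕ) : Measurable fun μ : ProbabilityMeasure X ↦
      ∫⁻ y, edist y x ∂(push (s n) μ : Measure X) :=
    ((continuous_lintegral_edist x).comp (continuous_push (s n))).measurable
  have hedist : Measurable fun y : X ↦ edist y x := by fun_prop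
  have hnorm (n : ℕ) : eLpNorm (G n - 0) 1 (ρ : Measure (ProbabilityMeasure X)) =
      ∫⁻ y, edist y x ∂(push (s n) (barycenter ρ) : Measure X) := by
    rw [sub_zero, eLpNorm_one_eq_lintegral_enorm, lintegral_push _ _ hedist,
      lintegral_barycenter ρ (f := fun y ↦ edist (s n y) x) (by fun_prop)]
    refine lintegral_congr fun μ ↦ ?_
    rw [Real.enorm_of_nonneg ENNReal.toReal_nonneg,
      ENNReal.ofReal_toReal (lintegral_edist_ne_top x _), lintegral_push _ _ hedist]
  have hlim : Tendsto (fun n ↦ eLpNorm (G n - 0) 1 (ρ : Measure (ProbabilityMeasure X)))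
      atTop (𝓝 0) := by
    simp_rw [hnorm]
    have h0 : ∫⁻ y, edist y x ∂(diracPM x : Measure X) = 0 := by
      change ∫⁻ y, edist y x ∂(Measure.dirac x) = 0
      rw [lintegral_dirac' x hedist, edist_self]
    exact h0 ▸ ((continuous_lintegral_edist x).tendsto _).comp h
  obtain ⟨ms, -, hms⟩ := (tendstoInMeasure_of_tendsto_eLpNorm one_ne_zero
    (fun n ↦ (hmeas n).ennreal_toReal.aestronglyMeasurable)
    aestronglyMeasurable_zero hlim).exists_seq_tendsto_ae
  refine ⟨ms, hms.mono fun μ hμ ↦ tendsto_diracPM_of_lintegral_edist ?_⟩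
  exact (ENNReal.tendsto_toReal_iff (fun n ↦ lintegral_edist_ne_top x _) ENNReal.zero_ne_top).1 hμ

theorem tendsto_push2_of_tendsto_push_barycenter {X : Type*} [PseudoMetricSpace X]
    [CompactSpace X] [MeasurableSpace X] [BorelSpace X]
    (ρ : ProbabilityMeasure (ProbabilityMeasure X)) {s : ℕ → C(X, X)} {x : X}
    (h : Tendsto (fun n ↦ push (s n) (barycenter ρ)) atTop (𝓝 (diracPM x))) :
    Tendsto (fun n ↦ push2 (s n) ρ) atTop (𝓝 (diracPM (diracPM x))) := by
  refine tendsto_of_subseq_tendsto fun ns hns ↦ ?_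
  obtain ⟨ms, hms⟩ := exists_subseq_ae_tendsto_push ρ (h.comp hns)
  refine ⟨ms, ProbabilityMeasure.tendsto_iff_forall_integral_tendsto.2 fun f ↦ ?_⟩
  have hdirac : ∫ μ, f μ ∂(diracPM (diracPM x) : Measure (ProbabilityMeasure X)) =
      ∫ _, f (diracPM x) ∂(ρ : Measure (ProbabilityMeasure X)) := by
    change ∫ μ, f μ ∂(Measure.dirac (diracPM x)) = _
    rw [integral_dirac' _ _ f.continuous.measurable.stronglyMeasurable]
    simp
  simp only [integral_push2, hdirac]
  refine tendsto_integral_of_dominated_convergence (fun _ ↦ ‖f‖)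
    (fun n ↦ (f.continuous.comp (continuous_push _)).measurable.aestronglyMeasurable)
    (integrable_const _) (fun n ↦ Eventually.of_forall fun μ ↦ f.norm_coe_le_norm _) ?_
  exact hms.mono fun μ hμ ↦ (f.continuous.tendsto _).comp hμ

/-- For a compact metric space `X`: if the action of the topological semigroup `T` on `X`
is strongly proximal, then the induced action of `T` on `P(X)` is strongly proximal. -/
theorem stmt11 {X : Type*} [MetricSpace X] [CompactSpace X] [MeasurableSpace X] [BorelSpace X]
    {T : Type*} [Semigroup T] [TopologicalSpace T] [ContinuousMul T]
    (act : T → C(X, X)) (hact : ∀ s t : T, act (s * t) = (act s).comp (act t))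
    (hsp : ∀ lam : ProbabilityMeasure X, ∃ (t : ℕ → T) (x : X),
      Tendsto (fun n => push (act (t n)) lam) atTop (𝓝 (diracPM x))) :
    ∀ ρ : ProbabilityMeasure (ProbabilityMeasure X), ∃ (t : ℕ → T) (x : X),
      Tendsto (fun n => push2 (act (t n)) ρ) atTop (𝓝 (diracPM (diracPM x))) := by
  intro ρ
  obtain ⟨t, x, h⟩ := hsp (barycenter ρ)
  exact ⟨t, x, tendsto_push2_of_tendsto_push_barycenter ρ h⟩
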